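/- arXiv:1709.02527 — 4 statements merged into one kernel-verified Lean document; each statement's English description precedes it below -/
import Mathlib

section
/- Let (V, J) be as in the context and R a Kähler algebraic curvature tensor on (V, J). If X, Y ∈ V are unit vectors such that X, JX, Y, JY are pairwise orthogonal, then R(X, Y, Y, X) + R(X, JY, JY, X) = (1/4)·[ H((X+JY)/√2) + H((X−JY)/√2) + H((X+Y)/√2) + H((X−Y)/√2) − H(X) − H(Y) ]. -/
open scoped RealInnerProductSpace

/-- Polarization of the quartic form `A ↦ R(A, JA, JA, A)` of a Kähler algebraic curvature
tensor. -/
theorem holomorphic_quartic_add_add_sub {V : Type*} [AddCommGroup V] [Module ℝ V]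
    (J : V →ₗ[ℝ] V) (hJ2 : ∀ X : V, J (J X) = -X)
    (R : V →ₗ[ℝ] V →ₗ[ℝ] V →ₗ[ℝ] V →ₗ[ℝ] ℝ)
    (hanti : ∀ X Y Z W : V, R X Y Z W = - R Y X Z W)
    (hsymm : ∀ X Y Z W : V, R X Y Z W = R Z W X Y)
    (hkahler : ∀ X Y Z W : V, R (J X) (J Y) Z W = R X Y Z W) (A B : V) :
    R (A + B) (J (A + B)) (J (A + B)) (A + B) + R (A - B) (J (A - B)) (J (A - B)) (A - B) =
      2 * R A (J A) (J A) A + 2 * R B (J B) (J B) B + 4 * R A (J A) (J B) B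
        + 8 * R A (J B) (J B) A := by
  have swap (Z W : V) : R Z (J W) = R W (J Z) := by
    ext U T
    have h := hkahler Z (J W) U T
    rw [hJ2, map_neg, LinearMap.neg_apply, LinearMap.neg_apply] at h
    linarith [hanti (J Z) W U T]
  have swap_right (U T Z W : V) : R U T (J Z) W = R U T (J W) Z := by
    have anti (P Q : V) : R U T P Q = - R U T Q P := by
      rw [hsymm U T P Q, hsymm U T Q P, hanti]
    rw [anti, anti (J W), hsymm, hsymm U T Z, swap]
  have e1 : R B (J B) (J A) A = R A (J A) (J B) B := by
    rw [hsymm, hanti, hsymm, hanti, hsymm, neg_neg]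
  have e2 : R B (J A) (J A) B = R A (J B) (J B) A := by
    rw [swap B A, swap_right]
  have e3 : R A (J B) (J A) B = R A (J B) (J B) A := swap_right _ _ _ _
  have e4 : R B (J A) (J B) A = R A (J B) (J B) A := by rw [swap B A]
  have sub_left (U Z W : V) : R (A - B) U Z W = R A U Z W - R B U Z W := by
    rw [hanti, map_sub, LinearMap.sub_apply, LinearMap.sub_apply, hanti A, hanti B]
    ring
  simp only [map_add, map_sub, LinearMap.add_apply, LinearMap.sub_apply, sub_left]
  linarith

/-- Berger's identity for the orthogonal bisectional curvature of a Kähler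
algebraic curvature tensor. -/
theorem orthBisec_eq_holomorphic_combination
    {V : Type*} [NormedAddCommGroup V] [InnerProductSpace ℝ V]
    [FiniteDimensional ℝ V]
    (J : V →ₗ[ℝ] V)
    (hJ2 : ∀ X : V, J (J X) = -X)
    (hJinner : ∀ X Y : V, ⟪J X, J Y⟫ = ⟪X, Y⟫)
    (R : V →ₗ[ℝ] V →ₗ[ℝ] V →ₗ[ℝ] V →ₗ[ℝ] ℝ)
    (hanti : ∀ X Y Z W : V, R X Y Z W = - R Y X Z W)
    (hsymm : ∀ X Y Z W : V, R X Y Z W = R Z W X Y)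
    (hbianchi : ∀ X Y Z W : V, R X Y Z W + R Y Z X W + R Z X Y W = 0)
    (hkahler : ∀ X Y Z W : V, R (J X) (J Y) Z W = R X Y Z W)
    (H : V → ℝ)
    (hH : ∀ X : V, H X = R X (J X) (J X) X / ‖X‖ ^ 4)
    (X Y : V) (hX : ‖X‖ = 1) (hY : ‖Y‖ = 1)
    (h1 : ⟪X, J X⟫ = 0) (h2 : ⟪X, Y⟫ = 0) (h3 : ⟪X, J Y⟫ = 0)
    (h4 : ⟪J X, Y⟫ = 0) (h5 : ⟪J X, J Y⟫ = 0) (h6 : ⟪Y, J Y⟫ = 0)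
    :
    R X Y Y X + R X (J Y) (J Y) X = (1 / 4) *
      (H ((Real.sqrt 2)⁻¹ • (X + J Y)) + H ((Real.sqrt 2)⁻¹ • (X - J Y))
        + H ((Real.sqrt 2)⁻¹ • (X + Y)) + H ((Real.sqrt 2)⁻¹ • (X - Y))
        - H X - H Y) := by
  have neg_right (U T Z W : V) : R U T Z W = - R U T W Z := by
    rw [hsymm U T Z W, hsymm U T W Z, hanti]
  have norm_J : ‖J Y‖ = 1 := by
    rw [norm_eq_sqrt_real_inner, hJinner, ← norm_eq_sqrt_real_inner, hY]
  have norm_sq_add (B : V) (hB : ‖B‖ = 1) (h : ⟪X, B⟫ = 0) : ‖X + B‖ ^ 2 = 2 := by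
    rw [norm_add_sq_real, hX, hB, h]; norm_num
  have norm_sq_sub (B : V) (hB : ‖B‖ = 1) (h : ⟪X, B⟫ = 0) : ‖X - B‖ ^ 2 = 2 := by
    rw [norm_sub_sq_real, hX, hB, h]; norm_num
  have H_smul (Z : V) (hZ : ‖Z‖ ^ 2 = 2) :
      H ((Real.sqrt 2)⁻¹ • Z) = R Z (J Z) (J Z) Z / 4 := by
    have hs : ((Real.sqrt 2)⁻¹) ^ 2 = 1 / 2 := by
      rw [inv_pow, Real.sq_sqrt (by norm_num)]; norm_num
    have hn : ‖(Real.sqrt 2)⁻¹ • Z‖ ^ 4 = 1 := by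
      rw [norm_smul, Real.norm_eq_abs, show 4 = 2 * 2 from rfl, pow_mul, mul_pow, sq_abs, hs, hZ]
      norm_num
    rw [hH, hn]
    simp only [map_smul, LinearMap.smul_apply, smul_eq_mul]
    linear_combination
      (((Real.sqrt 2)⁻¹) ^ 2 + 1 / 2) * R Z (J Z) (J Z) Z * hs
  have bisectional : R X (J X) (J Y) Y = R X Y Y X + R X (J Y) (J Y) X := by
    have hb := hbianchi X (J X) (J Y) Y
    have e1 : R (J X) (J Y) X Y = - R X Y Y X := by rw [hkahler, neg_right]
    have e2 : R (J Y) X (J X) Y = - R X (J Y) (J Y) X := by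
      rw [hanti, hsymm, ← hkahler (J X) Y, hJ2, hanti (-X), map_neg, LinearMap.neg_apply,
        LinearMap.neg_apply, neg_neg, hsymm]
    linarith
  have q1 := holomorphic_quartic_add_add_sub J hJ2 R hanti hsymm hkahler X Y
  have q2 := holomorphic_quartic_add_add_sub J hJ2 R hanti hsymm hkahler X (J Y)
  have e1 : R (J Y) (J (J Y)) (J (J Y)) (J Y) = R Y (J Y) (J Y) Y := by
    rw [hkahler, hJ2, neg_right]; simp
  have e2 : R X (J X) (J (J Y)) (J Y) = R X (J X) (J Y) Y := by
    rw [hJ2, neg_right]; simp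
  have e3 : R X (J (J Y)) (J (J Y)) X = R X Y Y X := by
    simp [hJ2]
  rw [e1, e2, e3] at q2
  rw [H_smul _ (norm_sq_add _ norm_J h3), H_smul _ (norm_sq_sub _ norm_J h3),
    H_smul _ (norm_sq_add _ hY h2), H_smul _ (norm_sq_sub _ hY h2), hH X, hH Y, hX, hY]
  linarith
end

section
/- Let (V, J) be as in the context and R a Kähler algebraic curvature tensor on (V, J). Suppose there are constants 0 < λ ≤ Λ such that λ ≤ H(X) ≤ Λ for every unit vector X ∈ V. Then for all unit vectors X, Y such that X, JX, Y, JY are pairwise orthogonal, (3λ − 2Λ)/4 ≤ R(X, Y, Y, X) ≤ (3Λ − 2λ)/4. -/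
open scoped RealInnerProductSpace

/-- Polarization of the quartic form `X ↦ R(X, JX, JX, X)` of a Kähler curvature tensor. -/
theorem kahler_quartic_add_add_quartic_sub {V : Type*} [AddCommGroup V] [Module ℝ V]
    {J : V →ₗ[ℝ] V} {R : V →ₗ[ℝ] V →ₗ[ℝ] V →ₗ[ℝ] V →ₗ[ℝ] ℝ}
    (hJ2 : ∀ X : V, J (J X) = -X)
    (hanti : ∀ X Y Z W : V, R X Y Z W = - R Y X Z W)
    (hsymm : ∀ X Y Z W : V, R X Y Z W = R Z W X Y)
    (hbianchi : ∀ X Y Z W : V, R X Y Z W + R Y Z X W + R Z X Y W = 0)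
    (hkahler : ∀ X Y Z W : V, R (J X) (J Y) Z W = R X Y Z W) (X Y : V) :
    R (X + Y) (J (X + Y)) (J (X + Y)) (X + Y) + R (X - Y) (J (X - Y)) (J (X - Y)) (X - Y) =
      2 * R X (J X) (J X) X + 2 * R Y (J Y) (J Y) Y
        + 12 * R X (J Y) (J Y) X + 4 * R X Y Y X := by
  have hanti' (A B C D : V) : R A B C D = - R A B D C := by
    rw [hsymm, hanti, hsymm]
  have hkahler' (A B C D : V) : R A B (J C) (J D) = R A B C D := by
    rw [hsymm, hkahler, hsymm]
  have e₁ : R Y (J X) (J X) Y = R X (J Y) (J Y) X := by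
    have h := hkahler Y (J X) (J X) Y
    have h' := hkahler' (J Y) X (J X) Y
    simp only [hJ2, map_neg, LinearMap.neg_apply] at h h'
    linarith [hanti (J Y) X X (J Y), hanti' X (J Y) X (J Y)]
  have e₂ : R Y (J X) (J Y) X = R X (J Y) (J Y) X := by
    have h := hkahler Y (J X) (J Y) X
    simp only [hJ2, map_neg, LinearMap.neg_apply] at h
    linarith [hanti (J Y) X (J Y) X]
  have e₃ : R X (J Y) (J X) Y = R X (J Y) (J Y) X := by
    have h := hkahler' X (J Y) (J X) Y
    simp only [hJ2, map_neg, LinearMap.neg_apply] at h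
    linarith [hanti' X (J Y) X (J Y)]
  have e₄ : R Y (J Y) (J X) X = R X (J X) (J Y) Y := by
    linarith [hsymm Y (J Y) (J X) X, hanti (J X) X Y (J Y), hanti' X (J X) Y (J Y)]
  have e₅ : R X (J X) (J Y) Y = R X (J Y) (J Y) X + R X Y Y X := by
    linarith [hbianchi X (J X) (J Y) Y, hkahler X Y X Y, hanti' X Y X Y,
      hanti (J Y) X (J X) Y]
  have map_sub_left (A A' B C D : V) :
      R (A - A') B C D = R A B C D - R A' B C D := by
    rw [hanti, hanti A, hanti A']
    simp only [map_sub, LinearMap.sub_apply]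
    ring
  simp only [map_add, map_sub, map_sub_left, LinearMap.add_apply, LinearMap.sub_apply]
  linarith

/-- Pinching of holomorphic sectional curvature bounds the sectional curvature of
pairs `(X, Y)` with `X, JX, Y, JY` pairwise orthogonal. -/
theorem sec_bounds_of_holomorphic_pinching
    {V : Type*} [NormedAddCommGroup V] [InnerProductSpace ℝ V]
    [FiniteDimensional ℝ V]
    (J : V →ₗ[ℝ] V)
    (hJ2 : ∀ X : V, J (J X) = -X)
    (hJinner : ∀ X Y : V, ⟪J X, J Y⟫ = ⟪X, Y⟫)
    (R : V →ₗ[ℝ] V →ₗ[ℝ] V →ₗ[ℝ] V →ₗ[ℝ] ℝ)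
    (hanti : ∀ X Y Z W : V, R X Y Z W = - R Y X Z W)
    (hsymm : ∀ X Y Z W : V, R X Y Z W = R Z W X Y)
    (hbianchi : ∀ X Y Z W : V, R X Y Z W + R Y Z X W + R Z X Y W = 0)
    (hkahler : ∀ X Y Z W : V, R (J X) (J Y) Z W = R X Y Z W)
    (H : V → ℝ)
    (hH : ∀ X : V, H X = R X (J X) (J X) X / ‖X‖ ^ 4)
    (lam Lam : ℝ) (hlam : 0 < lam) (hlamLam : lam ≤ Lam)
    (hpinch : ∀ Z : V, ‖Z‖ = 1 → lam ≤ H Z ∧ H Z ≤ Lam)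
    (X Y : V) (hX : ‖X‖ = 1) (hY : ‖Y‖ = 1)
    (h1 : ⟪X, J X⟫ = 0) (h2 : ⟪X, Y⟫ = 0) (h3 : ⟪X, J Y⟫ = 0)
    (h4 : ⟪J X, Y⟫ = 0) (h5 : ⟪J X, J Y⟫ = 0) (h6 : ⟪Y, J Y⟫ = 0)
    :
    (3 * lam - 2 * Lam) / 4 ≤ R X Y Y X ∧ R X Y Y X ≤ (3 * Lam - 2 * lam) / 4 := by
  have quartic_bounds (Z : V) (c : ℝ) (hZ : ‖Z‖ ^ 2 = c) (hc : 0 < c) :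
      lam * c ^ 2 ≤ R Z (J Z) (J Z) Z ∧ R Z (J Z) (J Z) Z ≤ Lam * c ^ 2 := by
    have hZ0 : ‖Z‖ ≠ 0 := by
      rintro h
      simp [h] at hZ
      linarith
    have h := hpinch ((‖Z‖)⁻¹ • Z) (by rw [norm_smul, norm_inv, norm_norm, inv_mul_cancel₀ hZ0])
    have hval : H ((‖Z‖)⁻¹ • Z) = R Z (J Z) (J Z) Z / c ^ 2 := by
      rw [hH, norm_smul, norm_inv, norm_norm, inv_mul_cancel₀ hZ0, ← hZ]
      simp only [map_smul, LinearMap.smul_apply, smul_eq_mul]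
      field_simp
    rwa [hval, le_div_iff₀ (by positivity), div_le_iff₀ (by positivity)] at h
  have norm_J : ‖J Y‖ = 1 := by
    have h := hJinner Y Y
    rw [real_inner_self_eq_norm_sq, real_inner_self_eq_norm_sq, hY] at h
    nlinarith [norm_nonneg (J Y)]
  have bX := quartic_bounds X 1 (by rw [hX]; norm_num) one_pos
  have bY := quartic_bounds Y 1 (by rw [hY]; norm_num) one_pos
  have bXY := quartic_bounds (X + Y) 2
    (by rw [norm_add_sq_real, hX, hY, h2]; norm_num) two_pos
  have bXY' := quartic_bounds (X - Y) 2
    (by rw [norm_sub_sq_real, hX, hY, h2]; norm_num) two_pos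
  have bXJ := quartic_bounds (X + J Y) 2
    (by rw [norm_add_sq_real, hX, norm_J, h3]; norm_num) two_pos
  have bXJ' := quartic_bounds (X - J Y) 2
    (by rw [norm_sub_sq_real, hX, norm_J, h3]; norm_num) two_pos
  have p := kahler_quartic_add_add_quartic_sub hJ2 hanti hsymm hbianchi hkahler X Y
  have p' := kahler_quartic_add_add_quartic_sub hJ2 hanti hsymm hbianchi hkahler X (J Y)
  have hJY : R (J Y) (J (J Y)) (J (J Y)) (J Y) = R Y (J Y) (J Y) Y := by
    rw [hkahler, hsymm, hkahler, hsymm, hanti, hsymm, hanti, hsymm]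
  have hXJY : R X (J (J Y)) (J (J Y)) X = R X Y Y X := by
    simp [hJ2]
  rw [hJY, hXJY] at p'
  constructor <;> linarith
end

section
/- Let (V, J) be as in the context and R a Kähler algebraic curvature tensor on (V, J). Let ε ≥ 0 and suppose 1/2 − ε ≤ H(X) ≤ 1 for every unit vector X ∈ V. Then for all unit vectors X, Y such that X, JX, Y, JY are pairwise orthogonal, the orthogonal bisectional curvature satisfies R(X, Y, Y, X) + R(X, JY, JY, X) ≥ −ε. In particular, if 1/2 ≤ H ≤ 1 then the orthogonal bisectional curvature is nonnegative. -/
open scoped RealInnerProductSpace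

section KaehlerCurvature

variable {V : Type*} [AddCommGroup V] [Module ℝ V] {J : V →ₗ[ℝ] V}
  {R : V →ₗ[ℝ] V →ₗ[ℝ] V →ₗ[ℝ] V →ₗ[ℝ] ℝ}

/-- Moving `J` between the first two slots of a Kähler curvature tensor changes the sign. -/
theorem curvature_J_left (hJ2 : ∀ X : V, J (J X) = -X)
    (hkahler : ∀ X Y Z W : V, R (J X) (J Y) Z W = R X Y Z W) (X Y Z W : V) :
    R (J X) Y Z W = - R X (J Y) Z W := by
  have h := hkahler X (J Y) Z W
  simp only [hJ2, map_neg, LinearMap.neg_apply] at h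
  linarith

/-- For a Kähler curvature tensor, `R(X, JX, JY, Y)` is the bisectional curvature
`R(X, Y, Y, X) + R(X, JY, JY, X)`. -/
theorem curvature_bisectional (hJ2 : ∀ X : V, J (J X) = -X)
    (hanti : ∀ X Y Z W : V, R X Y Z W = - R Y X Z W)
    (hsymm : ∀ X Y Z W : V, R X Y Z W = R Z W X Y)
    (hbianchi : ∀ X Y Z W : V, R X Y Z W + R Y Z X W + R Z X Y W = 0)
    (hkahler : ∀ X Y Z W : V, R (J X) (J Y) Z W = R X Y Z W) (X Y : V) :
    R X (J X) (J Y) Y = R X Y Y X + R X (J Y) (J Y) X := by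
  have hb := hbianchi X (J X) (J Y) Y
  have e₁ : R (J X) (J Y) X Y = - R X Y Y X := by
    rw [hkahler, hsymm, hanti, hsymm]
  have e₂ : R (J Y) X (J X) Y = - R X (J Y) (J Y) X := by
    rw [hanti, hsymm, curvature_J_left hJ2 hkahler, neg_neg, hanti, hsymm]
  linarith

/-- Averaging the quartic form `R(Z, JZ, JZ, Z)` over `Z = X ± Y, X ± JY` isolates the
bisectional curvature of `X` and `Y`. -/
theorem curvature_sum_four_phases (hJ2 : ∀ X : V, J (J X) = -X)
    (hanti : ∀ X Y Z W : V, R X Y Z W = - R Y X Z W)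
    (hsymm : ∀ X Y Z W : V, R X Y Z W = R Z W X Y)
    (hbianchi : ∀ X Y Z W : V, R X Y Z W + R Y Z X W + R Z X Y W = 0)
    (hkahler : ∀ X Y Z W : V, R (J X) (J Y) Z W = R X Y Z W) (X Y : V) :
    R (X + Y) (J (X + Y)) (J (X + Y)) (X + Y) + R (X - Y) (J (X - Y)) (J (X - Y)) (X - Y)
      + R (X + J Y) (J (X + J Y)) (J (X + J Y)) (X + J Y)
      + R (X - J Y) (J (X - J Y)) (J (X - J Y)) (X - J Y)
      = 4 * (R X (J X) (J X) X + R Y (J Y) (J Y) Y)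
        + 16 * (R X Y Y X + R X (J Y) (J Y) X) := by
  have hpair : ∀ Y : V,
      R (X + Y) (J (X + Y)) (J (X + Y)) (X + Y) + R (X - Y) (J (X - Y)) (J (X - Y)) (X - Y)
        = 2 * (R X (J X) (J X) X + R Y (J Y) (J Y) Y)
          + 4 * (R X Y Y X + R X (J Y) (J Y) X) + 8 * R X (J Y) (J Y) X := by
    intro Y
    have b := curvature_bisectional hJ2 hanti hsymm hbianchi hkahler X Y
    have swap : ∀ Z W : V, R Y (J X) Z W = R X (J Y) Z W := fun Z W => by
      rw [hanti, curvature_J_left hJ2 hkahler, neg_neg]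
    have swap' : ∀ Z W : V, R Z W (J X) Y = R Z W (J Y) X := fun Z W => by
      rw [hsymm, hsymm Z W, hanti (J X), hanti (J Y), swap]
    have c : R Y (J Y) (J X) X = R X (J X) (J Y) Y := by
      rw [hsymm, hanti, hsymm, hanti, hsymm, neg_neg, hsymm]
    have hsub : X - Y = X + (-1 : ℝ) • Y := by module
    simp only [hsub, map_add, map_smul, LinearMap.add_apply, LinearMap.smul_apply, smul_eq_mul]
    linarith [swap (J X) Y, swap (J Y) X, swap' X (J Y)]
  have h₁ := hpair Y
  have h₂ := hpair (J Y)
  have e₁ : R (J Y) (J (J Y)) (J (J Y)) (J Y) = R Y (J Y) (J Y) Y := by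
    rw [hkahler, hsymm, hkahler, hsymm]
  have e₂ : R X (J (J Y)) (J (J Y)) X = R X Y Y X := by
    simp only [hJ2, map_neg, LinearMap.neg_apply, neg_neg]
  rw [e₁, e₂] at h₂
  linarith

end KaehlerCurvature

/-- Almost one-half holomorphic pinching gives almost nonnegative orthogonal
bisectional curvature. -/
theorem orthBisec_almost_nonneg_of_almost_half_pinching
    {V : Type*} [NormedAddCommGroup V] [InnerProductSpace ℝ V]
    [FiniteDimensional ℝ V]
    (J : V →ₗ[ℝ] V)
    (hJ2 : ∀ X : V, J (J X) = -X)
    (hJinner : ∀ X Y : V, ⟪J X, J Y⟫ = ⟪X, Y⟫)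
    (R : V →ₗ[ℝ] V →ₗ[ℝ] V →ₗ[ℝ] V →ₗ[ℝ] ℝ)
    (hanti : ∀ X Y Z W : V, R X Y Z W = - R Y X Z W)
    (hsymm : ∀ X Y Z W : V, R X Y Z W = R Z W X Y)
    (hbianchi : ∀ X Y Z W : V, R X Y Z W + R Y Z X W + R Z X Y W = 0)
    (hkahler : ∀ X Y Z W : V, R (J X) (J Y) Z W = R X Y Z W)
    (H : V → ℝ)
    (hH : ∀ X : V, H X = R X (J X) (J X) X / ‖X‖ ^ 4)
    (ε : ℝ) (hε : 0 ≤ ε)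
    (hpinch : ∀ Z : V, ‖Z‖ = 1 → 1 / 2 - ε ≤ H Z ∧ H Z ≤ 1)
    (X Y : V) (hX : ‖X‖ = 1) (hY : ‖Y‖ = 1)
    (h1 : ⟪X, J X⟫ = 0) (h2 : ⟪X, Y⟫ = 0) (h3 : ⟪X, J Y⟫ = 0)
    (h4 : ⟪J X, Y⟫ = 0) (h5 : ⟪J X, J Y⟫ = 0) (h6 : ⟪Y, J Y⟫ = 0)
    :
    -ε ≤ R X Y Y X + R X (J Y) (J Y) X := by
  have hquartic : ∀ Z : V, ‖Z‖ ^ 2 = 2 → 4 * (1 / 2 - ε) ≤ R Z (J Z) (J Z) Z := by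
    intro Z hZ
    have hZ0 : ‖Z‖ ≠ 0 := fun h => by norm_num [h] at hZ
    have hunit : ‖(‖Z‖⁻¹ : ℝ) • Z‖ = 1 := by
      rw [norm_smul, norm_inv, norm_norm, inv_mul_cancel₀ hZ0]
    have h := (hpinch _ hunit).1
    rw [hH, hunit] at h
    simp only [map_smul, LinearMap.smul_apply, smul_eq_mul, one_pow, div_one] at h
    have h4 : ‖Z‖⁻¹ * (‖Z‖⁻¹ * (‖Z‖⁻¹ * (‖Z‖⁻¹ * R Z (J Z) (J Z) Z)))
        = R Z (J Z) (J Z) Z / 4 := by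
      have : (‖Z‖⁻¹) ^ 2 = 1 / 2 := by rw [inv_pow, hZ, one_div]
      linear_combination ((‖Z‖⁻¹) ^ 2 + 1 / 2) * R Z (J Z) (J Z) Z * this
    linarith
  have hJY : ‖J Y‖ ^ 2 = 1 := by
    rw [← real_inner_self_eq_norm_sq, hJinner, real_inner_self_eq_norm_sq, hY, one_pow]
  have q₁ := hquartic (X + Y) (by rw [norm_add_sq_real, h2, hX, hY]; norm_num)
  have q₂ := hquartic (X - Y) (by rw [norm_sub_sq_real, h2, hX, hY]; norm_num)
  have q₃ := hquartic (X + J Y) (by rw [norm_add_sq_real, h3, hX, hJY]; norm_num)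
  have q₄ := hquartic (X - J Y) (by rw [norm_sub_sq_real, h3, hX, hJY]; norm_num)
  have hXle := (hpinch X hX).2
  have hYle := (hpinch Y hY).2
  rw [hH, hX, one_pow, div_one] at hXle
  rw [hH, hY, one_pow, div_one] at hYle
  linarith [curvature_sum_four_phases hJ2 hanti hsymm hbianchi hkahler X Y]
end

section
/- Let (V, J) be as in the context and R a Kähler algebraic curvature tensor on (V, J), where V has real dimension 2n with n ≥ 1. If H(X) > 0 for every unit vector X ∈ V, then the scalar curvature is positive: for any orthonormal basis (e₁, …, e₂ₙ) of V, the sum Σᵢ Σⱼ R(eᵢ, eⱼ, eⱼ, eᵢ) is strictly positive. -/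
open scoped RealInnerProductSpace

/-- Flipping the sign at an index occurring exactly once shows that a mixed moment vanishes. -/
lemma sum_signs_mul_eq_zero {ι : Type*} [Fintype ι] [DecidableEq ι] (i : ι)
    (g : (ι → ℤˣ) → ℝ) (hg : ∀ ε, g (Function.update ε i (-ε i)) = g ε) :
    ∑ ε : ι → ℤˣ, ((ε i : ℤ) : ℝ) * g ε = 0 := by
  have hinv : Function.Involutive fun ε : ι → ℤˣ => Function.update ε i (-ε i) := by
    intro ε
    simp
  have h := Equiv.sum_comp hinv.toPerm fun ε : ι → ℤˣ => ((ε i : ℤ) : ℝ) * g ε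
  simp only [Function.Involutive.coe_toPerm, hg, Function.update_self, Units.val_neg,
    Int.cast_neg, neg_mul, Finset.sum_neg_distrib] at h
  linarith

lemma sum_signs_mul {ι : Type*} [Fintype ι] [DecidableEq ι] (i j : ι) :
    ∑ ε : ι → ℤˣ, ((ε i : ℤ) : ℝ) * ((ε j : ℤ) : ℝ) =
      Fintype.card (ι → ℤˣ) * if i = j then 1 else 0 := by
  split_ifs with h
  · subst h
    simp [← Int.cast_mul]
  · rw [mul_zero]
    exact sum_signs_mul_eq_zero i _ fun ε => by simp [Function.update_of_ne (Ne.symm h)]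

/-- The fourth moments of independent uniform random signs. -/
lemma sum_signs_mul_mul_mul {ι : Type*} [Fintype ι] [DecidableEq ι] (i j k l : ι) :
    ∑ ε : ι → ℤˣ, ((ε i : ℤ) : ℝ) * (((ε j : ℤ) : ℝ) * (((ε k : ℤ) : ℝ) * ((ε l : ℤ) : ℝ))) =
      Fintype.card (ι → ℤˣ) *
        ((if i = j then if k = l then 1 else 0 else 0) +
          (if i = k then if j = l then 1 else 0 else 0) +
          (if i = l then if j = k then 1 else 0 else 0) -
          2 * if i = j then if i = k then if i = l then 1 else 0 else 0 else 0) := by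
  have hsq : ∀ (ε : ι → ℤˣ) (m : ι) (x : ℝ),
      ((ε m : ℤ) : ℝ) * (((ε m : ℤ) : ℝ) * x) = x := fun ε m x => by
    rw [← mul_assoc, ← Int.cast_mul]
    simp
  by_cases hij : i = j
  · subst hij
    simp only [hsq, sum_signs_mul]
    grind
  by_cases hik : i = k
  · subst hik
    have : ∀ ε : ι → ℤˣ, ((ε i : ℤ) : ℝ) * (((ε j : ℤ) : ℝ) * (((ε i : ℤ) : ℝ) * ((ε l : ℤ) : ℝ)))
        = ((ε j : ℤ) : ℝ) * ((ε l : ℤ) : ℝ) := fun ε => by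
      rw [← hsq ε i (((ε j : ℤ) : ℝ) * ((ε l : ℤ) : ℝ))]
      ring
    simp only [this, sum_signs_mul]
    grind
  by_cases hil : i = l
  · subst hil
    have : ∀ ε : ι → ℤˣ, ((ε i : ℤ) : ℝ) * (((ε j : ℤ) : ℝ) * (((ε k : ℤ) : ℝ) * ((ε i : ℤ) : ℝ)))
        = ((ε j : ℤ) : ℝ) * ((ε k : ℤ) : ℝ) := fun ε => by
      rw [← hsq ε i (((ε j : ℤ) : ℝ) * ((ε k : ℤ) : ℝ))]
      ring
    simp only [this, sum_signs_mul]
    grind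
  · rw [sum_signs_mul_eq_zero i _ fun ε => by
      simp [Function.update_of_ne (Ne.symm hij), Function.update_of_ne (Ne.symm hik),
        Function.update_of_ne (Ne.symm hil)]]
    simp [hij, hik, hil]

/-- The sum of a quartic form over all sign vectors. -/
lemma sum_signs_quartic {ι : Type*} [Fintype ι] [DecidableEq ι] (T : ι → ι → ι → ι → ℝ) :
    ∑ ε : ι → ℤˣ, ∑ i, ∑ j, ∑ k, ∑ l,
      ((ε i : ℤ) : ℝ) * (((ε j : ℤ) : ℝ) * (((ε k : ℤ) : ℝ) * ((ε l : ℤ) : ℝ))) * T i j k l =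
      Fintype.card (ι → ℤˣ) *
        (∑ i, ∑ j, (T i i j j + T i j i j + T i j j i) - 2 * ∑ i, T i i i i) := by
  have h : ∑ ε : ι → ℤˣ, ∑ i, ∑ j, ∑ k, ∑ l,
      ((ε i : ℤ) : ℝ) * (((ε j : ℤ) : ℝ) * (((ε k : ℤ) : ℝ) * ((ε l : ℤ) : ℝ))) * T i j k l =
      ∑ i, ∑ j, ∑ k, ∑ l, (∑ ε : ι → ℤˣ,
        ((ε i : ℤ) : ℝ) * (((ε j : ℤ) : ℝ) * (((ε k : ℤ) : ℝ) * ((ε l : ℤ) : ℝ)))) *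
          T i j k l := by
    simp only [Finset.sum_mul]
    rw [Finset.sum_comm]
    refine Finset.sum_congr rfl fun i _ => ?_
    rw [Finset.sum_comm]
    refine Finset.sum_congr rfl fun j _ => ?_
    rw [Finset.sum_comm]
    refine Finset.sum_congr rfl fun k _ => ?_
    rw [Finset.sum_comm]
  rw [h]
  simp only [sum_signs_mul_mul_mul, mul_assoc, ← Finset.mul_sum]
  congr 1
  simp only [add_mul, sub_mul, mul_assoc, ite_mul, one_mul, zero_mul, Finset.sum_add_distrib,
    Finset.sum_sub_distrib, ← Finset.mul_sum, Finset.sum_ite_eq, Finset.sum_ite_irrel,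
    Finset.sum_const_zero, Finset.mem_univ, if_true]

/-- The trace of a bilinear form is invariant under an orthogonal complex structure. -/
lemma OrthonormalBasis.sum_apply_complexStructure {ι V : Type*} [Fintype ι]
    [NormedAddCommGroup V] [InnerProductSpace ℝ V] (b : OrthonormalBasis ι ℝ V)
    {J : V →ₗ[ℝ] V} (hJ2 : ∀ X, J (J X) = -X) (hJinner : ∀ X Y : V, ⟪J X, J Y⟫ = ⟪X, Y⟫)
    (f : V →ₗ[ℝ] V →ₗ[ℝ] ℝ) :
    ∑ j, f (J (b j)) (J (b j)) = ∑ j, f (b j) (b j) := by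
  have hskew : ∀ X Y : V, ⟪X, J Y⟫ = -⟪Y, J X⟫ := fun X Y => by
    rw [← hJinner X, hJ2, inner_neg_right, real_inner_comm]
  calc ∑ j, f (J (b j)) (J (b j))
      = ∑ j, ∑ k, ⟪b k, J (b j)⟫ * f (b k) (J (b j)) := by
        refine Finset.sum_congr rfl fun j _ => ?_
        conv_lhs => enter [1]; rw [← b.sum_repr' (J (b j))]
        simp
    _ = ∑ k, -f (b k) (J (∑ j, ⟪b j, J (b k)⟫ • b j)) := by
        rw [Finset.sum_comm]
        refine Finset.sum_congr rfl fun k _ => ?_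
        simp only [map_sum, map_smul, smul_eq_mul, ← Finset.sum_neg_distrib]
        exact Finset.sum_congr rfl fun j _ => by rw [hskew, neg_mul]
    _ = ∑ j, f (b j) (b j) := by simp [b.sum_repr', hJ2]

/-- Positive holomorphic sectional curvature implies positive scalar curvature. -/
theorem scalar_pos_of_holomorphic_pos
    {V : Type*} [NormedAddCommGroup V] [InnerProductSpace ℝ V]
    [FiniteDimensional ℝ V]
    (J : V →ₗ[ℝ] V)
    (hJ2 : ∀ X : V, J (J X) = -X)
    (hJinner : ∀ X Y : V, ⟪J X, J Y⟫ = ⟪X, Y⟫)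
    (R : V →ₗ[ℝ] V →ₗ[ℝ] V →ₗ[ℝ] V →ₗ[ℝ] ℝ)
    (hanti : ∀ X Y Z W : V, R X Y Z W = - R Y X Z W)
    (hsymm : ∀ X Y Z W : V, R X Y Z W = R Z W X Y)
    (hbianchi : ∀ X Y Z W : V, R X Y Z W + R Y Z X W + R Z X Y W = 0)
    (hkahler : ∀ X Y Z W : V, R (J X) (J Y) Z W = R X Y Z W)
    (H : V → ℝ)
    (hH : ∀ X : V, H X = R X (J X) (J X) X / ‖X‖ ^ 4)
    (n : ℕ) (hn : 1 ≤ n) (hdim : Module.finrank ℝ V = 2 * n)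
    (hpos : ∀ Z : V, ‖Z‖ = 1 → 0 < H Z)
    (b : OrthonormalBasis (Fin (2 * n)) ℝ V) :
    0 < ∑ i : Fin (2 * n), ∑ j : Fin (2 * n), R (b i) (b j) (b j) (b i) := by
  have hnonneg : ∀ X : V, 0 ≤ R X (J X) (J X) X := fun X => by
    rcases eq_or_ne X 0 with rfl | hX
    · simp
    have hnorm : ‖‖X‖⁻¹ • X‖ = 1 := norm_smul_inv_norm (𝕜 := ℝ) hX
    have h := hpos _ hnorm
    rw [hH, hnorm] at h
    have hX' : 0 < ‖X‖⁻¹ := inv_pos.2 (norm_pos_iff.2 hX)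
    simp only [map_smul, LinearMap.smul_apply, smul_eq_mul, one_pow, div_one] at h
    rw [mul_pos_iff_of_pos_left hX', mul_pos_iff_of_pos_left hX', mul_pos_iff_of_pos_left hX',
      mul_pos_iff_of_pos_left hX'] at h
    exact h.le
  have hdiag : 0 < ∑ i, R (b i) (J (b i)) (J (b i)) (b i) := by
    have : Nonempty (Fin (2 * n)) := ⟨⟨0, by omega⟩⟩
    refine Finset.sum_pos (fun i _ => ?_) Finset.univ_nonempty
    have h := hpos (b i) (b.norm_eq_one i)
    rwa [hH, b.norm_eq_one, one_pow, div_one] at h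
  have hsigns := sum_signs_quartic fun i j k l => R (b i) (J (b j)) (J (b k)) (b l)
  have hexpand : ∀ ε : Fin (2 * n) → ℤˣ, ∑ i, ∑ j, ∑ k, ∑ l,
      ((ε i : ℤ) : ℝ) * (((ε j : ℤ) : ℝ) * (((ε k : ℤ) : ℝ) * ((ε l : ℤ) : ℝ))) *
        R (b i) (J (b j)) (J (b k)) (b l) =
      R (∑ i, ((ε i : ℤ) : ℝ) • b i) (J (∑ i, ((ε i : ℤ) : ℝ) • b i))
        (J (∑ i, ((ε i : ℤ) : ℝ) • b i)) (∑ i, ((ε i : ℤ) : ℝ) • b i) := fun ε => by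
    simp only [map_sum (R : V →ₗ[ℝ] V →ₗ[ℝ] V →ₗ[ℝ] V →ₗ[ℝ] ℝ), map_smul,
      LinearMap.sum_apply, LinearMap.smul_apply]
    refine Finset.sum_congr rfl fun i _ => ?_
    simp only [map_sum, map_smul, LinearMap.sum_apply, LinearMap.smul_apply, smul_eq_mul,
      Finset.mul_sum, mul_assoc]
    symm
    rw [Finset.sum_comm]
    refine (Finset.sum_congr rfl fun _ _ => Finset.sum_comm).trans ?_
    rw [Finset.sum_comm]
    refine Finset.sum_congr rfl fun j _ => Finset.sum_congr rfl fun k _ =>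
      Finset.sum_congr rfl fun l _ => ?_
    ring
  have hB : ∀ X Y : V, R X (J Y) (J X) Y = R (J X) Y Y (J X) := fun X Y => by
    have h1 := hkahler X (J Y) (J X) Y
    rw [hJ2] at h1
    simp only [map_neg, LinearMap.neg_apply] at h1
    rw [hsymm (J X) Y Y, hanti Y (J X)]
    linarith
  have hA : ∀ X Y : V, R X (J X) (J Y) Y = R X Y Y X + R X (J Y) (J X) Y := fun X Y => by
    have h1 := hbianchi X (J X) (J Y) Y
    have h2 := hkahler X Y X Y
    have h3 := hsymm X Y Y X
    have h4 := hanti Y X X Y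
    have h5 := hanti X (J Y) (J X) Y
    linarith
  have hC : ∑ i, ∑ j, R (b i) (J (b j)) (J (b j)) (b i) =
      ∑ i, ∑ j, R (b i) (b j) (b j) (b i) :=
    Finset.sum_congr rfl fun i _ =>
      b.sum_apply_complexStructure hJ2 hJinner ((R (b i)).compr₂ (LinearMap.applyₗ (b i)))
  have hBsum : ∑ i, ∑ j, R (b i) (J (b j)) (J (b i)) (b j) =
      ∑ i, ∑ j, R (b i) (b j) (b j) (b i) := by
    rw [← hC, Finset.sum_comm]
    exact Finset.sum_congr rfl fun j _ => Finset.sum_congr rfl fun i _ => by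
      rw [hB, hsymm (J (b i))]
  have hAsum : ∑ i, ∑ j, R (b i) (J (b i)) (J (b j)) (b j) =
      ∑ i, ∑ j, R (b i) (b j) (b j) (b i) +
        ∑ i, ∑ j, R (b i) (J (b j)) (J (b i)) (b j) := by
    simp only [← Finset.sum_add_distrib]
    exact Finset.sum_congr rfl fun i _ => Finset.sum_congr rfl fun j _ => hA _ _
  have hsum_nonneg := Finset.sum_nonneg fun (ε : Fin (2 * n) → ℤˣ) (_ : ε ∈ Finset.univ) =>
    hnonneg (∑ i, ((ε i : ℤ) : ℝ) • b i)
  simp only [← hexpand] at hsum_nonneg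
  rw [hsigns] at hsum_nonneg
  have hmoment := nonneg_of_mul_nonneg_right hsum_nonneg (Nat.cast_pos.2 Fintype.card_pos)
  simp only [Finset.sum_add_distrib, hAsum, hBsum, hC] at hmoment
  linarith
end
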